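/- For any partial tiling T contained in some tiling of the punctured hull Ω_punc whose support contains the origin, the set ξ_T = {[t,P,t] ∈ E : t = T(0), t ∈ P ⊆ T} is a filter in the idempotent semilattice E of the tiling inverse semigroup S. -/

import Mathlib

/- Shared framework: tilings of ℝⁿ and the tiling inverse semigroup (Kellendonk),
   following Exel–Gonçalves–Starling. -/
open Set
open scoped Classical
noncomputable section

abbrev Rn (n : ℕ) := EuclideanSpace ℝ (Fin n)

/-- A prototile: a subset of ℝⁿ homeomorphic to the closed unit ball, carrying a label,
with the origin (the designated puncture) in its interior. -/
structure ProtoTile (n : ℕ) where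
  carrier : Set (Rn n)
  label : ℕ
  ball_like : Nonempty (carrier ≃ₜ (Metric.closedBall (0 : Rn n) 1 : Set (Rn n)))
  origin_mem : (0 : Rn n) ∈ interior carrier

/-- A tile: a translate `p + x` of a prototile `p`; `puncture` is the translation vector,
i.e. the designated point `x(t)` of the tile. -/
structure Tile (n : ℕ) where
  proto : ProtoTile n
  puncture : Rn n

namespace Tile

def carrier {n : ℕ} (t : Tile n) : Set (Rn n) := (fun y => y + t.puncture) '' t.proto.carrier

def translate {n : ℕ} (t : Tile n) (x : Rn n) : Tile n := ⟨t.proto, t.puncture + x⟩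

end Tile

/-- `T + x`, the translate of a collection of tiles. -/
def translateSet {n : ℕ} (T : Set (Tile n)) (x : Rn n) : Set (Tile n) :=
  (fun t => t.translate x) '' T

/-- A partial tiling: tiles with pairwise disjoint interiors. -/
def IsPartialTiling {n : ℕ} (T : Set (Tile n)) : Prop :=
  T.Pairwise fun t t' => interior t.carrier ∩ interior t'.carrier = ∅

/-- The support of a partial tiling. -/
def tsupport' {n : ℕ} (T : Set (Tile n)) : Set (Rn n) := ⋃ t ∈ T, t.carrier

/-- A tiling: a partial tiling whose support is all of ℝⁿ. -/
def IsTiling {n : ℕ} (T : Set (Tile n)) : Prop := IsPartialTiling T ∧ tsupport' T = univ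

/-- A patch: a finite partial tiling. -/
def IsPatch {n : ℕ} (P : Set (Tile n)) : Prop := IsPartialTiling P ∧ P.Finite

/-- `T(U)`: the tiles of `T` meeting the set `U`. -/
def tilesMeeting {n : ℕ} (T : Set (Tile n)) (U : Set (Rn n)) : Set (Tile n) :=
  {t | t ∈ T ∧ (t.carrier ∩ U).Nonempty}

/-- The tiling metric. -/
def tdist {n : ℕ} (T T' : Set (Tile n)) : ℝ :=
  sInf ({1} ∪ {ε : ℝ | 0 < ε ∧ ∃ x x' : Rn n, ‖x‖ < ε ∧ ‖x'‖ < ε ∧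
    tilesMeeting (translateSet T (-x)) (Metric.ball (0 : Rn n) (1/ε)) =
      tilesMeeting (translateSet T' (-x')) (Metric.ball (0 : Rn n) (1/ε))})

/-- Finite local complexity: for each `r > 0` there are only finitely many patches
`T(B(x,r))` up to translation. -/
def FLC {n : ℕ} (T : Set (Tile n)) : Prop :=
  ∀ r : ℝ, 0 < r → ∃ F : Set (Set (Tile n)), F.Finite ∧
    ∀ x : Rn n, ∃ P ∈ F, ∃ y : Rn n, tilesMeeting T (Metric.ball x r) = translateSet P y

/-- Repetitivity. -/
def Repetitive {n : ℕ} (T : Set (Tile n)) : Prop :=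
  ∀ P ⊆ T, IsPatch P → ∃ R : ℝ, 0 < R ∧ ∀ x : Rn n, ∃ y : Rn n,
    translateSet P y ⊆ tilesMeeting T (Metric.ball x R)

def IsPeriodic {n : ℕ} (T : Set (Tile n)) : Prop :=
  ∃ x : Rn n, x ≠ 0 ∧ translateSet T x = T

/-- The continuous hull `Ω_T`, characterized as the set of all tilings every patch of
which appears as a translate of a patch of `T`. -/
def hull {n : ℕ} (T : Set (Tile n)) : Set (Set (Tile n)) :=
  {T' | IsTiling T' ∧ ∀ P ⊆ T', IsPatch P → ∃ x : Rn n, translateSet P x ⊆ T}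

/-- Strong aperiodicity: the hull contains no periodic tiling. -/
def StronglyAperiodic {n : ℕ} (T : Set (Tile n)) : Prop := ∀ T' ∈ hull T, ¬ IsPeriodic T'

/-- The punctured hull: tilings of the hull with a puncture at the origin. -/
def puncturedHull {n : ℕ} (T : Set (Tile n)) : Set (Set (Tile n)) :=
  {T' | T' ∈ hull T ∧ ∃ t ∈ T', t.puncture = 0}

/-- `U(P,t) = {T' : P - x(t) ⊆ T'}`. -/
def U {n : ℕ} (P : Set (Tile n)) (t : Tile n) : Set (Set (Tile n)) :=
  {T' | translateSet P (-t.puncture) ⊆ T'}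

/-- The (tiling-metric) topology on the punctured hull: generated by the balls of `tdist`. -/
def punctopology {n : ℕ} (T : Set (Tile n)) : TopologicalSpace ↥(puncturedHull T) :=
  TopologicalSpace.generateFrom
    {V | ∃ T₀ ∈ puncturedHull T, ∃ ε : ℝ, 0 < ε ∧
      V = {T' : ↥(puncturedHull T) | tdist (T' : Set (Tile n)) T₀ < ε}}

/-- A representative `(t₁, P, t₂)` of a doubly-pointed pattern class of the tiling `T`:
`P` is a patch occurring in `T` whose support has connected interior, `t₁, t₂ ∈ P`. -/
structure SRep (n : ℕ) (T : Set (Tile n)) where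
  t1 : Tile n
  t2 : Tile n
  P : Set (Tile n)
  mem1 : t1 ∈ P
  mem2 : t2 ∈ P
  patch : IsPatch P
  conn : IsConnected (interior (tsupport' P))
  occurs : ∃ x : Rn n, translateSet P x ⊆ T

namespace SRep

variable {n : ℕ} {T : Set (Tile n)}

/-- The involution `[t₁,P,t₂]* = [t₂,P,t₁]`. -/
def star (s : SRep n T) : SRep n T := ⟨s.t2, s.t1, s.P, s.mem2, s.mem1, s.patch, s.conn, s.occurs⟩

/-- A representative of `s* s = [t₂,P,t₂]`. -/
def srcIdem (s : SRep n T) : SRep n T :=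
  ⟨s.t2, s.t2, s.P, s.mem2, s.mem2, s.patch, s.conn, s.occurs⟩

/-- A representative of `s s* = [t₁,P,t₁]`. -/
def ranIdem (s : SRep n T) : SRep n T :=
  ⟨s.t1, s.t1, s.P, s.mem1, s.mem1, s.patch, s.conn, s.occurs⟩

/-- Two triples represent the same doubly-pointed pattern class. -/
def Equiv' (a b : SRep n T) : Prop :=
  ∃ x : Rn n, a.t1.translate x = b.t1 ∧ a.t2.translate x = b.t2 ∧ translateSet a.P x = b.P

/-- The product `[t₁,P,t₂][t₁',P',t₂']` is nonzero: there are translations making both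
patches of `T` with `t₂ + x = t₁' + x'`. -/
def Compat (a b : SRep n T) : Prop :=
  ∃ x x' : Rn n, translateSet a.P x ⊆ T ∧ translateSet b.P x' ⊆ T ∧
    a.t2.translate x = b.t1.translate x'

/-- `c` represents the (nonzero) product of the classes of `a` and `b`:
`[t₁+x, (P+x) ∪ (P'+x'), t₂'+x']`. -/
def Prod' (a b c : SRep n T) : Prop :=
  ∃ x x' : Rn n, translateSet a.P x ⊆ T ∧ translateSet b.P x' ⊆ T ∧
    a.t2.translate x = b.t1.translate x' ∧
    ∃ y : Rn n, c.t1.translate y = a.t1.translate x ∧ c.t2.translate y = b.t2.translate x' ∧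
      translateSet c.P y = translateSet a.P x ∪ translateSet b.P x'

/-- The natural order on idempotent classes, concretely: `e ≤ f` iff for suitable
representatives `t = t'` and `P' ⊆ P`. -/
def le (e f : SRep n T) : Prop :=
  ∃ x : Rn n, f.t1.translate x = e.t1 ∧ translateSet f.P x ⊆ e.P

end SRep

/-- `g` represents `s* e s`. -/
def Prod3 {n : ℕ} {T : Set (Tile n)} (s e g : SRep n T) : Prop :=
  ∃ a : SRep n T, SRep.Prod' (SRep.star s) e a ∧ SRep.Prod' a s g

/-- A filter in the idempotent semilattice `E` of the tiling inverse semigroup, encoded as a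
translation-saturated set of idempotent representatives: nonempty, upward closed and downward
directed (zero is excluded automatically since only nonzero idempotents have representatives). -/
def IsFilterE {n : ℕ} (T : Set (Tile n)) (ξ : Set (SRep n T)) : Prop :=
  ξ.Nonempty ∧ (∀ e ∈ ξ, e.t1 = e.t2) ∧
  (∀ e ∈ ξ, ∀ f : SRep n T, f.t1 = f.t2 → SRep.le e f → f ∈ ξ) ∧
  (∀ e ∈ ξ, ∀ f ∈ ξ, ∃ g ∈ ξ, SRep.le g e ∧ SRep.le g f)

/-- An ultrafilter: a maximal filter. -/
def IsUltraE {n : ℕ} (T : Set (Tile n)) (ξ : Set (SRep n T)) : Prop :=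
  IsFilterE T ξ ∧ ∀ ζ : Set (SRep n T), IsFilterE T ζ → ξ ⊆ ζ → ζ = ξ

/-- `ξ_{T₀} = {[t,P,t] : t = T₀(0), t ∈ P ⊆ T₀}`: the idempotents whose patch, positioned with
its distinguished tile having puncture at the origin, lies in `T₀`. -/
def xiOf {n : ℕ} (T : Set (Tile n)) (T₀ : Set (Tile n)) : Set (SRep n T) :=
  {e | e.t1 = e.t2 ∧ ∃ x : Rn n, (e.t1.translate x).puncture = 0 ∧
    e.t1.translate x ∈ T₀ ∧ translateSet e.P x ⊆ T₀}

/-- The partial tiling `⋃ {P : [t,P,t] ∈ ξ}` associated to a filter (each patch positioned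
with the puncture of its distinguished tile at the origin). -/
def tilingOf {n : ℕ} {T : Set (Tile n)} (ξ : Set (SRep n T)) : Set (Tile n) :=
  ⋃ e ∈ ξ, translateSet e.P (-(e.t1.puncture))

/-- A character of the idempotent semilattice `E`: nonzero, constant on classes,
multiplicative, and vanishing on zero products. -/
def IsCharE {n : ℕ} (T : Set (Tile n)) (φ : SRep n T → Bool) : Prop :=
  (∃ e, φ e = true) ∧
  (∀ e f : SRep n T, SRep.Equiv' e f → φ e = φ f) ∧
  (∀ e f g : SRep n T, e.t1 = e.t2 → f.t1 = f.t2 → SRep.Prod' e f g → φ g = (φ e && φ f)) ∧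
  (∀ e f : SRep n T, e.t1 = e.t2 → f.t1 = f.t2 → ¬ SRep.Compat e f →
    ¬(φ e = true ∧ φ f = true))

/-- The character `φ_{T₀}` of a tiling `T₀` of the punctured hull. -/
def charOf {n : ℕ} (T : Set (Tile n)) (T₀ : Set (Tile n)) : SRep n T → Bool :=
  fun e => decide (e ∈ xiOf T T₀)

/-- A point `(s, T')` of the set `Y`: `T' ∈ Ω_punc` lies in the domain `U(P,t₂)` of `θ_s`. -/
structure GermPt (n : ℕ) (T : Set (Tile n)) where
  s : SRep n T
  tl : Set (Tile n)
  mem_hull : tl ∈ puncturedHull T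
  mem_dom : tl ∈ U s.P s.t2

/-- The germ relation: `(s,T') ∼ (s'',T'')` iff `T' = T''` and there is an idempotent
`e = [t,P'',t]` with `T' ∈ U(P'',t)` and `s e = s'' e` (as classes). -/
def GermRel {n : ℕ} (T : Set (Tile n)) (p q : GermPt n T) : Prop :=
  p.tl = q.tl ∧ ∃ e : SRep n T, e.t1 = e.t2 ∧ p.tl ∈ U e.P e.t1 ∧
    ∃ g h : SRep n T, SRep.Prod' p.s e g ∧ SRep.Prod' q.s e h ∧ SRep.Equiv' g h

/-- The germ topology on the groupoid of germs: basic open sets `Θ(s,V)` for `V` an open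
subset of `U(P,t₂)`. -/
def germTop {n : ℕ} (T : Set (Tile n)) : TopologicalSpace (Quot (GermRel T)) :=
  TopologicalSpace.generateFrom
    {W | ∃ (s : SRep n T) (V : Set (Set (Tile n))),
      (letI := punctopology T;
        IsOpen {T' : ↥(puncturedHull T) | (T' : Set (Tile n)) ∈ V}) ∧
      V ⊆ U s.P s.t2 ∧
      W = {g | ∃ p : GermPt n T, p.s = s ∧ p.tl ∈ V ∧ Quot.mk (GermRel T) p = g}}

/-- `R_punc`: pairs `(T' + x, T')` of punctured-hull tilings which are translates. -/
def RpuncSet {n : ℕ} (T : Set (Tile n)) : Set (Set (Tile n) × Set (Tile n)) :=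
  {q | q.1 ∈ puncturedHull T ∧ q.2 ∈ puncturedHull T ∧ ∃ x : Rn n, q.1 = translateSet q.2 x}

/-- The topology `R_punc` inherits from `Ω_punc × ℝⁿ`. -/
def rpuncTop {n : ℕ} (T : Set (Tile n)) : TopologicalSpace ↥(RpuncSet T) :=
  letI := punctopology T
  TopologicalSpace.induced
    (fun q : ↥(RpuncSet T) =>
      ((⟨q.val.2, q.property.2.1⟩ : ↥(puncturedHull T)), Classical.choose q.property.2.2))
    inferInstance

theorem aux_poly {n : ℕ} (A : Rn n →L[ℝ] Rn n) :
    ∃ p : Polynomial ℝ, p.natDegree ≤ n ∧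
      ∀ t : ℝ, p.eval t = (ContinuousLinearMap.id ℝ (Rn n) + t • A).det := by
  let b := (EuclideanSpace.basisFun (Fin n) ℝ).toBasis
  let M := LinearMap.toMatrix b b (A : Rn n →ₗ[ℝ] Rn n)
  refine ⟨Matrix.det ((Polynomial.X : Polynomial ℝ) • M.map Polynomial.C
    + (1 : Matrix (Fin n) (Fin n) ℝ).map Polynomial.C), ?_, ?_⟩
  · simpa using Polynomial.natDegree_det_X_add_C_le M 1
  · intro t
    have h : (ContinuousLinearMap.id ℝ (Rn n) + t • A).det
        = Matrix.det ((1 : Matrix (Fin n) (Fin n) ℝ) + t • M) := by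
      rw [ContinuousLinearMap.det, ← LinearMap.det_toMatrix b]
      congr 1
      simp [M, LinearMap.toMatrix_id]
    rw [h, ← Polynomial.coe_evalRingHom, RingHom.map_det]
    congr 1
    ext i j
    by_cases hij : i = j <;> simp [hij, add_comm] <;> ring

theorem aux_det_pos {n : ℕ} (B : Rn n →L[ℝ] Rn n) (hB : ‖B‖ ≤ 1 / 2) :
    0 < (ContinuousLinearMap.id ℝ (Rn n) + B).det := by
  have hne : ∀ s ∈ Icc (0 : ℝ) 1, (ContinuousLinearMap.id ℝ (Rn n) + s • B).det ≠ 0 := by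
    intro s hs h
    have := LinearMap.bot_lt_ker_of_det_eq_zero h
    obtain ⟨v, hv, hv0⟩ := Submodule.exists_mem_ne_zero_of_ne_bot this.ne'
    have h1 : v + s • B v = 0 := by simpa using hv
    have h2 : v = - (s • B v) := eq_neg_of_add_eq_zero_left h1
    have h3 : ‖v‖ = s * ‖B v‖ := by
      conv_lhs => rw [h2]
      rw [norm_neg, norm_smul, Real.norm_of_nonneg hs.1]
    have h4 := B.le_opNorm v
    have h5 : 0 < ‖v‖ := norm_pos_iff.2 hv0
    nlinarith [hs.1, hs.2, norm_nonneg (B v)]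
  by_contra hcon
  push Not at hcon
  have hc : ContinuousOn (fun s : ℝ => (ContinuousLinearMap.id ℝ (Rn n) + s • B).det) (Icc 0 1) := by
    apply Continuous.continuousOn
    exact ContinuousLinearMap.continuous_det.comp (by fun_prop)
  have := intermediate_value_Icc' (zero_le_one) hc
  obtain ⟨s, hs, hs'⟩ := this (show (0:ℝ) ∈ _ by
    refine ⟨by simpa using hcon, ?_⟩
    have : (ContinuousLinearMap.id ℝ (Rn n)).det = 1 := by
      simp [ContinuousLinearMap.det]
    show (0:ℝ) ≤ (ContinuousLinearMap.id ℝ (Rn n) + (0:ℝ) • B).det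
    have e : ContinuousLinearMap.id ℝ (Rn n) + (0:ℝ) • B = ContinuousLinearMap.id ℝ (Rn n) := by
      ext; simp
    rw [e, this]
    exact zero_le_one)
  exact hne s hs hs'

open MeasureTheory in
theorem aux_vol {n : ℕ} (f : Rn n → Rn n) (hf : ContDiff ℝ 1 f) (h1 : ∀ x, ‖f x‖ = 1)
    (hs : ∀ x, ‖x‖ = 1 → f x = x) (C : ℝ) (hC : 0 < C)
    (hCb : ∀ x ∈ Metric.closedBall (0 : Rn n) 1, ‖fderiv ℝ f x - ContinuousLinearMap.id ℝ (Rn n)‖ ≤ C)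
    (t : ℝ) (ht : 0 < t) (ht1 : t < 1) (htC : t * C ≤ 1 / 2) :
    ∫ x in Metric.ball (0 : Rn n) 1, (ContinuousLinearMap.id ℝ (Rn n) + t •
      (fderiv ℝ f x - ContinuousLinearMap.id ℝ (Rn n))).det
      = volume.real (Metric.ball (0 : Rn n) 1) := by
  set F : Rn n → Rn n := fun x => x + t • (f x - x) with hF
  have hfd : Differentiable ℝ f := hf.differentiable (by norm_num)
  have hFd : ∀ x, HasFDerivAt F (ContinuousLinearMap.id ℝ (Rn n) + t •
      (fderiv ℝ f x - ContinuousLinearMap.id ℝ (Rn n))) x := fun x =>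
    (hasFDerivAt_id x).add (((hfd x).hasFDerivAt.sub (hasFDerivAt_id x)).const_smul t)
  have hgl : ∀ x ∈ Metric.closedBall (0 : Rn n) 1, ∀ y ∈ Metric.closedBall (0 : Rn n) 1,
      ‖(f x - x) - (f y - y)‖ ≤ C * ‖x - y‖ := by
    intro x hx y hy
    exact (convex_closedBall (0 : Rn n) 1).norm_image_sub_le_of_norm_hasFDerivWithin_le
      (f := fun x => f x - x) (fun z _ => ((hfd z).hasFDerivAt.sub (hasFDerivAt_id z)).hasFDerivWithinAt)
      hCb hy hx
  have happ : ApproximatesLinearOn F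
      ((ContinuousLinearEquiv.refl ℝ (Rn n) : Rn n ≃L[ℝ] Rn n) : Rn n →L[ℝ] Rn n)
      (Metric.ball 0 1) (1/2 : NNReal) := by
    intro x hx y hy
    have := hgl x (Metric.ball_subset_closedBall hx) y (Metric.ball_subset_closedBall hy)
    have e : F x - F y - (x - y) = t • ((f x - x) - (f y - y)) := by
      simp only [hF, smul_sub]; abel
    simp only [ContinuousLinearEquiv.coe_coe, ContinuousLinearEquiv.refl_apply, ContinuousLinearEquiv.coe_refl, ContinuousLinearMap.coe_id', id]
    rw [e, norm_smul, Real.norm_of_nonneg ht.le]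
    push_cast
    calc t * _ ≤ t * (C * ‖x - y‖) := by gcongr
      _ = (t * C) * ‖x - y‖ := by ring
      _ ≤ _ := by gcongr
  have hc : Subsingleton (Rn n) ∨ (1/2 : NNReal) <
      ‖((ContinuousLinearEquiv.refl ℝ (Rn n)).symm : Rn n →L[ℝ] Rn n)‖₊⁻¹ := by
    by_cases h : Subsingleton (Rn n)
    · exact Or.inl h
    · right
      rw [not_subsingleton_iff_nontrivial] at h
      have : ‖((ContinuousLinearEquiv.refl ℝ (Rn n)).symm : Rn n →L[ℝ] Rn n)‖₊ = 1 := by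
        ext
        simpa using ContinuousLinearMap.norm_id (𝕜 := ℝ) (E := Rn n)
      rw [this]
      norm_num
  have hinj : InjOn F (Metric.ball 0 1) := happ.injOn hc
  have hopen : IsOpen (F '' Metric.ball 0 1) := by
    have := (happ.toOpenPartialHomeomorph F _ hc Metric.isOpen_ball).open_target
    simpa using this
  have hmaps : ∀ x ∈ Metric.ball (0 : Rn n) 1, F x ∈ Metric.ball (0 : Rn n) 1 := by
    intro x hx
    rw [mem_ball_zero_iff] at *
    have : F x = (1 - t) • x + t • f x := by simp only [hF, smul_sub, sub_smul, one_smul]; abel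
    rw [this]
    calc _ ≤ ‖(1 - t) • x‖ + ‖t • f x‖ := norm_add_le _ _
      _ = (1 - t) * ‖x‖ + t := by
        rw [norm_smul, norm_smul, h1, Real.norm_of_nonneg ht.le, Real.norm_of_nonneg (by linarith)]; ring
      _ < 1 := by nlinarith
  have hFc : Continuous F := by
    have := hf.continuous
    fun_prop
  have himg : F '' Metric.ball 0 1 = Metric.ball 0 1 := by
    apply Subset.antisymm
    · rintro _ ⟨x, hx, rfl⟩; exact hmaps x hx
    · have hcl : IsClosed (F '' Metric.closedBall 0 1) :=
        ((isCompact_closedBall (0 : Rn n) 1).image hFc).isClosed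
      have hsph : ∀ x ∈ Metric.closedBall (0 : Rn n) 1, F x ∈ Metric.ball (0 : Rn n) 1 →
          x ∈ Metric.ball (0 : Rn n) 1 := by
        intro x hx hFx
        rw [mem_ball_zero_iff] at *
        rw [mem_closedBall_zero_iff] at hx
        refine lt_of_le_of_ne hx fun h => ?_
        have : F x = x := by simp [hF, hs x h]
        rw [this] at hFx
        exact hFx.ne h
      refine (convex_ball (0 : Rn n) 1).isPreconnected.subset_left_of_subset_union
        hopen hcl.isOpen_compl ?_ ?_ ?_
      · rw [disjoint_compl_right_iff_subset]
        exact image_mono Metric.ball_subset_closedBall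
      · intro y hy
        by_cases h : y ∈ F '' Metric.closedBall 0 1
        · obtain ⟨x, hx, rfl⟩ := h
          exact Or.inl ⟨x, hsph x hx hy, rfl⟩
        · exact Or.inr h
      · exact ⟨F 0, hmaps 0 (by simp), 0, by simp, rfl⟩
  have key := integral_image_eq_integral_abs_det_fderiv_smul volume
    (Metric.isOpen_ball (x := (0 : Rn n)) (ε := 1)).measurableSet
    (fun x _ => (hFd x).hasFDerivWithinAt) hinj (fun _ => (1 : ℝ))
  rw [himg] at key
  simp only [smul_eq_mul, mul_one, integral_const, measureReal_restrict_apply_univ] at key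
  rw [key]
  refine setIntegral_congr_fun Metric.isOpen_ball.measurableSet fun x hx => ?_
  have : ‖t • (fderiv ℝ f x - ContinuousLinearMap.id ℝ (Rn n))‖ ≤ 1 / 2 := by
    rw [norm_smul, Real.norm_of_nonneg ht.le]
    refine le_trans ?_ htC
    have := hCb x (Metric.ball_subset_closedBall hx)
    gcongr
  exact (abs_of_pos (aux_det_pos _ this)).symm

open MeasureTheory in
theorem aux_no_retract {n : ℕ} (f : Rn n → Rn n) (hf : ContDiff ℝ 1 f) (h1 : ∀ x, ‖f x‖ = 1)
    (hs : ∀ x, ‖x‖ = 1 → f x = x) : False := by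
  have hfd : Differentiable ℝ f := hf.differentiable (by norm_num)
  have hcont : Continuous fun x => fderiv ℝ f x - ContinuousLinearMap.id ℝ (Rn n) :=
    (hf.continuous_fderiv (by norm_num)).sub continuous_const
  obtain ⟨C0, hC0⟩ := (isCompact_closedBall (0 : Rn n) 1).exists_bound_of_continuousOn hcont.continuousOn
  set C := max C0 1 with hCdef
  have hC : 0 < C := lt_of_lt_of_le one_pos (le_max_right _ _)
  have hCb : ∀ x ∈ Metric.closedBall (0 : Rn n) 1, ‖fderiv ℝ f x - ContinuousLinearMap.id ℝ (Rn n)‖ ≤ C :=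
    fun x hx => (hC0 x hx).trans (le_max_left _ _)
  let v : ℕ → ℝ := fun i => 1 / (2 * C * (i + 1))
  have hvinj : Function.Injective v := by
    intro i j hij
    simp only [v, one_div, inv_inj] at hij
    have := mul_left_cancel₀ (by positivity) hij
    exact_mod_cast add_right_cancel this
  have hv : ∀ i, 0 < v i ∧ v i < 1 ∧ v i * C ≤ 1 / 2 := by
    intro i
    have hC1 : 1 ≤ C := le_max_right _ _
    have hi : (0 : ℝ) ≤ i := i.cast_nonneg
    refine ⟨by positivity, ?_, ?_⟩
    · simp only [v]
      rw [div_lt_one (by positivity)]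
      nlinarith [mul_nonneg hC.le hi]
    · simp only [v]
      rw [div_mul_eq_mul_div, div_le_div_iff₀ (by positivity) (by positivity)]
      nlinarith [mul_nonneg hC.le hi]
  let c : ℕ → ℝ := fun i => (Lagrange.basis (Finset.range (n+1)) v i).eval 1
  have hcsum : ∑ i ∈ Finset.range (n+1), c i = 1 := by
    have := Lagrange.sum_basis (s := Finset.range (n+1)) (v := v) hvinj.injOn ⟨0, by simp⟩
    have := congrArg (Polynomial.eval 1) this
    simpa [Polynomial.eval_finsetSum] using this
  have hpt : ∀ x, (fderiv ℝ f x).det = ∑ i ∈ Finset.range (n+1), c i *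
      (ContinuousLinearMap.id ℝ (Rn n) + v i •
      (fderiv ℝ f x - ContinuousLinearMap.id ℝ (Rn n))).det := by
    intro x
    obtain ⟨p, hp, hpe⟩ := aux_poly (fderiv ℝ f x - ContinuousLinearMap.id ℝ (Rn n))
    have h := Lagrange.eq_interpolate (s := Finset.range (n+1)) (v := v) (f := p) hvinj.injOn (by
      rw [Finset.card_range]
      refine lt_of_le_of_lt Polynomial.degree_le_natDegree ?_
      exact_mod_cast Nat.lt_succ_of_le hp)
    have h2 := congrArg (Polynomial.eval 1) h
    rw [hpe 1] at h2
    simp only [one_smul, add_sub_cancel] at h2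
    rw [h2, Lagrange.interpolate_apply, Polynomial.eval_finsetSum]
    refine Finset.sum_congr rfl fun i _ => ?_
    rw [Polynomial.eval_mul, Polynomial.eval_C, hpe, mul_comm]
  have hdet0 : ∀ x, (fderiv ℝ f x).det = 0 := by
    intro x
    by_contra hne
    have hsurj : Function.Surjective (fderiv ℝ f x) := by
      have hu : IsUnit (LinearMap.det (fderiv ℝ f x : Rn n →ₗ[ℝ] Rn n)) := isUnit_iff_ne_zero.2 hne
      exact (LinearMap.equivOfDetNeZero _ hne).surjective
    obtain ⟨w, hw⟩ := hsurj (f x)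
    have hd : HasFDerivAt (fun y => ‖f y‖ ^ 2) _ x := (hfd x).hasFDerivAt.norm_sq
    have hd' : HasFDerivAt (fun y => ‖f y‖ ^ 2) (0 : Rn n →L[ℝ] ℝ) x := by
      simp only [h1]; exact hasFDerivAt_const _ _
    have := congrArg (fun L : Rn n →L[ℝ] ℝ => L w) (hd.unique hd')
    simp [hw, h1] at this
  have hint : ∀ i ∈ Finset.range (n+1), Integrable (fun x => c i *
      (ContinuousLinearMap.id ℝ (Rn n) + v i •
      (fderiv ℝ f x - ContinuousLinearMap.id ℝ (Rn n))).det) (volume.restrict (Metric.ball (0 : Rn n) 1)) := by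
    intro i _
    have hc' : Continuous fun x => c i * (ContinuousLinearMap.id ℝ (Rn n) + v i •
      (fderiv ℝ f x - ContinuousLinearMap.id ℝ (Rn n))).det :=
      continuous_const.mul (ContinuousLinearMap.continuous_det.comp
        (by fun_prop))
    exact (hc'.continuousOn.integrableOn_compact (isCompact_closedBall (0 : Rn n) 1)).mono_set
      Metric.ball_subset_closedBall
  have h0 : ∫ x in Metric.ball (0 : Rn n) 1, (fderiv ℝ f x).det = 0 := by simp [hdet0]
  simp only [hpt] at h0
  rw [integral_finsetSum _ hint] at h0
  simp only [integral_const_mul] at h0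
  rw [Finset.sum_congr rfl (fun i _ => by
    rw [aux_vol f hf h1 hs C hC hCb (v i) (hv i).1 (hv i).2.1 (hv i).2.2]), ← Finset.sum_mul, hcsum,
    one_mul] at h0
  have hpos : 0 < volume (Metric.ball (0 : Rn n) 1) := Metric.measure_ball_pos _ _ one_pos
  rw [measureReal_eq_zero_iff (measure_ball_lt_top.ne)] at h0
  exact hpos.ne' h0

open scoped ContDiff in
theorem aux_smooth {n : ℕ} (F : Rn n → Rn n) (hF : Continuous F) (K : Set (Rn n)) (hK : IsCompact K)
    (ε : ℝ) (hε : 0 < ε) : ∃ g : Rn n → Rn n, ContDiff ℝ ∞ g ∧ ∀ x ∈ K, ‖g x - F x‖ < ε := by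
  have : UniformContinuousOn F (Metric.cthickening 1 K) :=
    hK.cthickening.uniformContinuousOn_of_continuous hF.continuousOn
  rcases Metric.uniformContinuousOn_iff.mp this (ε / 2) (half_pos hε) with ⟨δ, hδ, hfδ⟩
  rcases hF.exists_contDiff_dist_le_of_forall_mem_ball_dist_le
    (lt_min one_pos hδ) with ⟨g, hgc, hg⟩
  refine ⟨g, hgc, fun x hx ↦ ?_⟩
  rw [← dist_eq_norm]
  refine (hg _ _ fun y hy ↦ ?_).trans_lt (half_lt_self hε)
  rw [Metric.mem_ball, lt_min_iff] at hy
  exact hfδ _ (Metric.mem_cthickening_of_dist_le _ x _ _ hx hy.1.le) _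
    (Metric.self_subset_cthickening _ hx) hy.2 |>.le

theorem aux_stable {n : ℕ} (F₀ : Rn n → Rn n) (hF₀ : ContinuousOn F₀ (Metric.closedBall 0 1))
    (hid₀ : ∀ x ∈ Metric.closedBall (0 : Rn n) 1, ‖F₀ x - x‖ ≤ 1 / 2) :
    ∃ x ∈ Metric.closedBall (0 : Rn n) 1, F₀ x = 0 := by
  obtain ⟨F', hF'⟩ := ContinuousMap.exists_restrict_eq (Metric.isClosed_closedBall (x := (0 : Rn n)) (ε := 1))
    (⟨_, continuousOn_iff_continuous_domRestrict.1 hF₀⟩ : C(Metric.closedBall (0 : Rn n) 1, Rn n))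
  have hFF : ∀ x ∈ Metric.closedBall (0 : Rn n) 1, F' x = F₀ x := fun x hx =>
    congrArg (fun G : C(Metric.closedBall (0 : Rn n) 1, Rn n) => G ⟨x, hx⟩) hF'
  by_contra hcon
  push Not at hcon
  have hne : ∀ x ∈ Metric.closedBall (0 : Rn n) 1, F' x ≠ 0 := fun x hx => by
    rw [hFF x hx]; exact hcon x hx
  have hid : ∀ x ∈ Metric.closedBall (0 : Rn n) 1, ‖F' x - x‖ ≤ 1 / 2 := fun x hx => by
    rw [hFF x hx]; exact hid₀ x hx
  obtain ⟨x0, hx0, hmin⟩ := (isCompact_closedBall (0 : Rn n) 1).exists_isMinOn ⟨0, by simp⟩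
    (F'.continuous.norm.continuousOn)
  have hδ : 0 < ‖F' x0‖ := norm_pos_iff.2 (hne x0 hx0)
  obtain ⟨g, hg, hgF⟩ := aux_smooth F' F'.continuous _ (isCompact_closedBall (0 : Rn n) 1)
    (min ‖F' x0‖ (1/4)) (lt_min hδ (by norm_num))
  have hg0 : ∀ x ∈ Metric.closedBall (0 : Rn n) 1, g x ≠ 0 := by
    intro x hx h
    have h1 := (hgF x hx).trans_le (min_le_left _ _)
    rw [h, zero_sub, norm_neg] at h1
    exact absurd (hmin hx) (not_le.2 h1)
  have hgid : ∀ x ∈ Metric.closedBall (0 : Rn n) 1, ‖g x - x‖ ≤ 3 / 4 := by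
    intro x hx
    have h1 := (hgF x hx).trans_le (min_le_right _ _)
    have h2 := hid x hx
    have h3 := norm_add_le (g x - F' x) (F' x - x)
    rw [sub_add_sub_cancel] at h3
    linarith
  let χ : ContDiffBump (0 : Rn n) := ⟨7/8, 1, by norm_num, by norm_num⟩
  let h : Rn n → Rn n := fun x => x + χ x • (g x - x)
  have hh : ContDiff ℝ 1 h :=
    contDiff_id.add (χ.contDiff.smul ((hg.of_le (by norm_cast)).sub contDiff_id))
  have hout : ∀ x, 1 ≤ ‖x‖ → h x = x := by
    intro x hx
    have : χ x = 0 := χ.zero_of_le_dist (by simpa [χ] using hx)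
    simp [h, this]
  have hne' : ∀ x, h x ≠ 0 := by
    intro x hx0
    rcases le_or_gt 1 ‖x‖ with h1 | h1
    · rw [hout x h1] at hx0
      rw [hx0, norm_zero] at h1
      linarith
    · have hxb : x ∈ Metric.closedBall (0 : Rn n) 1 := by simpa using h1.le
      rcases le_or_gt ‖x‖ (7/8) with h2 | h2
      · have : χ x = 1 := χ.one_of_mem_closedBall (by simpa [χ] using h2)
        simp only [h, this, one_smul, add_sub_cancel] at hx0
        exact hg0 x hxb hx0
      · have h3 : x = - (χ x • (g x - x)) := eq_neg_of_add_eq_zero_left hx0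
        have h4 : ‖x‖ = χ x * ‖g x - x‖ := by
          conv_lhs => rw [h3]
          rw [norm_neg, norm_smul, Real.norm_of_nonneg χ.nonneg]
        have h5 := hgid x hxb
        nlinarith [χ.nonneg (x := x), χ.le_one (x := x), norm_nonneg (g x - x)]
  refine aux_no_retract (fun x => ‖h x‖⁻¹ • h x)
    (((hh.norm ℝ hne').inv (fun x => norm_ne_zero_iff.2 (hne' x))).smul hh) ?_ ?_
  · intro x
    rw [norm_smul, norm_inv, norm_norm, inv_mul_cancel₀ (norm_ne_zero_iff.2 (hne' x))]
  · intro x hx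
    simp [hout x hx.ge, hx]

open MeasureTheory in
theorem aux_invdom0 {n : ℕ} (f : Rn n → Rn n) (hf : ContinuousOn f (Metric.closedBall 0 1))
    (hinj : InjOn f (Metric.closedBall 0 1)) : f '' Metric.closedBall 0 1 ∈ nhds (f 0) := by
  set B := Metric.closedBall (0 : Rn n) 1 with hB
  have h0B : (0 : Rn n) ∈ B := by simp [hB]
  have hBc : IsCompact B := isCompact_closedBall _ _
  have : CompactSpace B := isCompact_iff_compactSpace.1 hBc
  have hemb : Topology.IsClosedEmbedding (B.domRestrict f) :=
    (continuousOn_iff_continuous_domRestrict.1 hf).isClosedEmbedding (injOn_iff_injective.1 hinj)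
  obtain ⟨G, hG⟩ := ContinuousMap.exists_extension' hemb
    (⟨Subtype.val, continuous_subtype_val⟩ : C(B, Rn n))
  have hGf : ∀ x ∈ B, G (f x) = x := fun x hx => congrFun hG ⟨x, hx⟩
  have hG0 : G (f 0) = 0 := hGf 0 h0B
  by_contra hcon
  obtain ⟨ε', hε', hGε'⟩ := Metric.continuousAt_iff.1 (G.continuous.continuousAt (x := f 0)) (1/10) (by norm_num)
  set ε := ε' / 2 with hεd
  have hε : 0 < ε := by positivity
  obtain ⟨c, hcε, hcn⟩ : ∃ c ∈ Metric.ball (f 0) ε, c ∉ f '' B := by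
    by_contra hh
    push Not at hh
    exact hcon (Filter.mem_of_superset (Metric.ball_mem_nhds _ hε) hh)
  have hGs : ∀ y, ‖y - c‖ ≤ ε → ‖G y‖ ≤ 1 / 10 := by
    intro y hy
    have : dist y (f 0) < ε' := by
      have h1 := dist_triangle y c (f 0)
      rw [Metric.mem_ball] at hcε
      rw [dist_eq_norm y c] at h1
      linarith
    have := hGε' this
    rw [hG0, dist_zero_right] at this
    exact this.le
  have hKc : IsCompact (f '' B) := hBc.image_of_continuousOn hf
  have hS1 : IsCompact (f '' B \ Metric.ball c ε) := hKc.diff Metric.isOpen_ball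
  have hG1 : ∀ y ∈ f '' B \ Metric.ball c ε, G y ≠ 0 := by
    rintro _ ⟨⟨x, hx, rfl⟩, hy⟩ h
    rw [hGf x hx] at h
    rw [h] at hy
    exact hy (Metric.mem_ball_comm.1 hcε)
  obtain ⟨δ, hδ, hδ1, hδG⟩ : ∃ δ : ℝ, 0 < δ ∧ δ ≤ 1/10 ∧ ∀ y ∈ f '' B \ Metric.ball c ε, δ ≤ ‖G y‖ := by
    rcases (f '' B \ Metric.ball c ε).eq_empty_or_nonempty with he | hne
    · exact ⟨1/10, by norm_num, le_rfl, by simp [he]⟩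
    · obtain ⟨y0, hy0, hmin⟩ := hS1.exists_isMinOn hne G.continuous.norm.continuousOn
      exact ⟨min ‖G y0‖ (1/10), lt_min (norm_pos_iff.2 (hG1 y0 hy0)) (by norm_num), min_le_right _ _,
        fun y hy => (min_le_left _ _).trans (hmin hy)⟩
  obtain ⟨P, hP, hPG⟩ := aux_smooth G G.continuous _ (hKc.union (isCompact_closedBall c ε)) (δ/2) (by positivity)
  have hnull : volume (P '' Metric.sphere c ε) = 0 :=
    addHaar_image_eq_zero_of_differentiableOn_of_addHaar_eq_zero volume
      ((hP.differentiable (by simp)).differentiableOn) (Measure.addHaar_sphere_of_ne_zero _ _ hε.ne')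
  obtain ⟨a, ha, han⟩ : ∃ a ∈ Metric.ball (0 : Rn n) (δ/2), a ∉ P '' Metric.sphere c ε := by
    by_contra hh
    push Not at hh
    have h1 : 0 < volume (Metric.ball (0 : Rn n) (δ/2)) := Metric.measure_ball_pos _ _ (by positivity)
    have h2 := measure_mono (μ := volume) (show Metric.ball (0 : Rn n) (δ/2) ⊆ _ from hh)
    rw [hnull] at h2
    exact absurd h2 (not_le.2 h1)
  rw [mem_ball_zero_iff] at ha
  have hQG : ∀ y ∈ f '' B ∪ Metric.closedBall c ε, ‖(P y - a) - G y‖ < δ := by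
    intro y hy
    have h1 := hPG y hy
    have h2 := norm_sub_le (P y - G y) a
    rw [show P y - G y - a = P y - a - G y by abel] at h2
    linarith
  let Φ : Rn n → Rn n := fun y => c + (max (ε / ‖y - c‖) 1) • (y - c)
  have hΦ1 : ∀ y, ε ≤ ‖y - c‖ → Φ y = y := by
    intro y hy
    have : ε / ‖y - c‖ ≤ 1 := div_le_one_of_le₀ hy (norm_nonneg _)
    simp [Φ, max_eq_right this]
  have hΦ2 : ∀ y, y ≠ c → ‖y - c‖ < ε → Φ y ∈ Metric.sphere c ε := by
    intro y hyc hy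
    have hp : 0 < ‖y - c‖ := norm_pos_iff.2 (sub_ne_zero.2 hyc)
    have : 1 ≤ ε / ‖y - c‖ := (one_le_div hp).2 hy.le
    rw [mem_sphere_iff_norm]
    simp only [Φ, max_eq_left this, add_sub_cancel_left, norm_smul]
    rw [Real.norm_of_nonneg (by positivity), div_mul_cancel₀ _ hp.ne']
  have hfc : ∀ x ∈ B, f x ≠ c := fun x hx h => hcn ⟨x, hx, h⟩
  have hcontF : ContinuousOn (fun x => P (Φ (f x)) - a) B := by
    refine ContinuousOn.sub (hP.continuous.comp_continuousOn ?_) continuousOn_const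
    have hd : ContinuousOn (fun x => ε / ‖f x - c‖) B :=
      continuousOn_const.div (hf.sub continuousOn_const).norm
        (fun x hx => norm_ne_zero_iff.2 (sub_ne_zero.2 (hfc x hx)))
    have hm : ContinuousOn (fun x => max (ε / ‖f x - c‖) 1) B := hd.sup continuousOn_const
    show ContinuousOn (fun x => c + (max (ε / ‖f x - c‖) 1) • (f x - c)) B
    have hs : ContinuousOn (fun x => (max (ε / ‖f x - c‖) 1) • (f x - c)) B :=
      hm.smul (hf.sub continuousOn_const)
    exact continuousOn_const.add hs
  obtain ⟨x, hx, hx0⟩ := aux_stable _ hcontF (by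
    intro x hx
    rcases le_or_gt ε ‖f x - c‖ with h | h
    · simp only [hΦ1 _ h]
      have := hQG (f x) (Or.inl ⟨x, hx, rfl⟩)
      rw [hGf x hx] at this
      linarith
    · have hs := hΦ2 _ (hfc x hx) h
      have h1 := hQG _ (Or.inr (Metric.sphere_subset_closedBall hs))
      have h2 := hGs _ (mem_sphere_iff_norm.1 hs).le
      have h3 := hGs _ h.le
      rw [hGf x hx] at h3
      have h4 := norm_add_le (P (Φ (f x)) - a - G (Φ (f x))) (G (Φ (f x)) - x)
      have h5 := norm_sub_le (G (Φ (f x))) x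
      rw [sub_add_sub_cancel] at h4
      linarith)
  rcases le_or_gt ε ‖f x - c‖ with h | h
  · simp only [hΦ1 _ h] at hx0
    have h1 := hQG (f x) (Or.inl ⟨x, hx, rfl⟩)
    rw [hx0, zero_sub, norm_neg] at h1
    have h2 := hδG (f x) ⟨⟨x, hx, rfl⟩, by rw [mem_ball_iff_norm]; exact not_lt.2 h⟩
    linarith
  · exact han ⟨_, hΦ2 _ (hfc x hx) h, sub_eq_zero.1 hx0⟩

theorem aux_invdom {n : ℕ} (f : Rn n → Rn n) (x : Rn n) (r : ℝ) (hr : 0 < r)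
    (hf : ContinuousOn f (Metric.closedBall x r))
    (hinj : InjOn f (Metric.closedBall x r)) : f '' Metric.closedBall x r ∈ nhds (f x) := by
  have hm : MapsTo (fun y : Rn n => x + r • y) (Metric.closedBall 0 1) (Metric.closedBall x r) := by
    intro y hy
    rw [mem_closedBall_zero_iff] at hy
    rw [mem_closedBall_iff_norm, add_sub_cancel_left, norm_smul, Real.norm_of_nonneg hr.le]
    nlinarith
  have h := aux_invdom0 (fun y => f (x + r • y)) (hf.comp (by fun_prop) hm) (by
    intro y hy z hz hyz
    have := hinj (hm hy) (hm hz) hyz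
    exact smul_right_injective _ hr.ne' (add_left_cancel this))
  simp only [smul_zero, add_zero] at h
  refine Filter.mem_of_superset h ?_
  rintro _ ⟨y, hy, rfl⟩
  exact ⟨_, hm hy, rfl⟩

theorem aux_tile {n : ℕ} (C : Set (Rn n))
    (h : C ≃ₜ (Metric.closedBall (0 : Rn n) 1 : Set (Rn n))) :
    IsConnected (interior C) ∧ C ⊆ closure (interior C) := by
  set B := Metric.closedBall (0 : Rn n) 1 with hB
  let φ : Rn n → Rn n := fun x => if hx : x ∈ B then (h.symm ⟨x, hx⟩ : Rn n) else 0
  let ψ : Rn n → Rn n := fun x => if hx : x ∈ C then (h ⟨x, hx⟩ : Rn n) else 0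
  have hφ : ∀ x (hx : x ∈ B), φ x = h.symm ⟨x, hx⟩ := fun x hx => dif_pos hx
  have hψ : ∀ x (hx : x ∈ C), ψ x = h ⟨x, hx⟩ := fun x hx => dif_pos hx
  have hφc : ContinuousOn φ B := by
    rw [continuousOn_iff_continuous_domRestrict]
    have : B.domRestrict φ = fun x => (h.symm x : Rn n) := by
      funext x; exact hφ x x.2
    rw [this]; exact continuous_subtype_val.comp h.symm.continuous
  have hψc : ContinuousOn ψ C := by
    rw [continuousOn_iff_continuous_domRestrict]
    have : C.domRestrict ψ = fun x => (h x : Rn n) := by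
      funext x; exact hψ x x.2
    rw [this]; exact continuous_subtype_val.comp h.continuous
  have hφm : ∀ x ∈ B, φ x ∈ C := fun x hx => by rw [hφ x hx]; exact (h.symm _).2
  have hψm : ∀ x ∈ C, ψ x ∈ B := fun x hx => by rw [hψ x hx]; exact (h _).2
  have hψφ : ∀ x ∈ B, ψ (φ x) = x := fun x hx => by
    rw [hψ _ (hφm x hx)]; simp [hφ x hx]
  have hφψ : ∀ x ∈ C, φ (ψ x) = x := fun x hx => by
    rw [hφ _ (hψm x hx)]; simp [hψ x hx]
  have hφi : InjOn φ B := fun x hx y hy hxy => by rw [← hψφ x hx, hxy, hψφ y hy]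
  have hψi : InjOn ψ C := fun x hx y hy hxy => by rw [← hφψ x hx, hxy, hφψ y hy]
  have hsub : Metric.ball (0 : Rn n) 1 ⊆ B := Metric.ball_subset_closedBall
  have hint : interior C = φ '' Metric.ball 0 1 := by
    apply Subset.antisymm
    · intro y hy
      obtain ⟨r, hr, hrC⟩ := Metric.nhds_basis_closedBall.mem_iff.1 (mem_interior_iff_mem_nhds.1 hy)
      have h1 := aux_invdom ψ y r hr (hψc.mono hrC) (hψi.mono hrC)
      have h2 : B ∈ nhds (ψ y) := Filter.mem_of_superset h1 (by
        rintro _ ⟨z, hz, rfl⟩; exact hψm z (hrC hz))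
      have h3 : ψ y ∈ interior B := mem_interior_iff_mem_nhds.2 h2
      rw [hB, interior_closedBall _ one_ne_zero] at h3
      exact ⟨_, h3, hφψ y (interior_subset hy)⟩
    · rintro _ ⟨x, hx, rfl⟩
      obtain ⟨r, hr, hrC⟩ := Metric.nhds_basis_closedBall.mem_iff.1 (Metric.isOpen_ball.mem_nhds hx)
      have h1 := aux_invdom φ x r hr (hφc.mono (hrC.trans hsub)) (hφi.mono (hrC.trans hsub))
      refine mem_interior_iff_mem_nhds.2 (Filter.mem_of_superset h1 ?_)
      rintro _ ⟨z, hz, rfl⟩; exact hφm z (hsub (hrC hz))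
  have hcl : closure (Metric.ball (0 : Rn n) 1) = B := closure_ball _ one_ne_zero
  refine ⟨?_, ?_⟩
  · rw [hint]
    exact (Metric.isConnected_ball (x := (0 : Rn n)) one_pos).image _ (hφc.mono hsub)
  · intro y hy
    rw [hint]
    refine ContinuousOn.image_closure (by rw [hcl]; exact hφc) ?_
    rw [hcl]
    exact ⟨ψ y, hψm y hy, hφψ y hy⟩

theorem aux_carrier {n : ℕ} (t : Tile n) :
    IsConnected (interior t.carrier) ∧ t.carrier ⊆ closure (interior t.carrier) := by
  obtain ⟨h⟩ := t.proto.ball_like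
  obtain ⟨h1, h2⟩ := aux_tile _ h
  have e : t.carrier = (Homeomorph.addRight t.puncture) '' t.proto.carrier := rfl
  rw [e, ← Homeomorph.image_interior, ← Homeomorph.image_closure]
  exact ⟨h1.image _ (Homeomorph.continuous _).continuousOn, image_mono h2⟩

theorem aux_puncture {n : ℕ} (t : Tile n) (ht : t.puncture = 0) :
    (0 : Rn n) ∈ interior t.carrier := by
  have e : t.carrier = t.proto.carrier := by simp [Tile.carrier, ht]
  rw [e]; exact t.proto.origin_mem

theorem aux_supp {n : ℕ} (P : Set (Tile n)) :
    tsupport' P ⊆ closure (interior (tsupport' P)) := by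
  intro y hy
  obtain ⟨t, ht, hyt⟩ := mem_iUnion₂.1 hy
  have hsub : t.carrier ⊆ tsupport' P := fun z hz => mem_iUnion₂.2 ⟨t, ht, hz⟩
  exact closure_mono (interior_mono hsub) ((aux_carrier t).2 hyt)

theorem aux_tr_tr {n : ℕ} (t : Tile n) (x y : Rn n) :
    (t.translate x).translate y = t.translate (x + y) := by
  simp [Tile.translate, add_assoc]

theorem aux_trS {n : ℕ} (P : Set (Tile n)) (x y : Rn n) :
    translateSet (translateSet P x) y = translateSet P (x + y) := by
  simp [translateSet, image_image, aux_tr_tr]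

theorem aux_tr_carrier {n : ℕ} (t : Tile n) (x : Rn n) :
    (t.translate x).carrier = (Homeomorph.addRight x) '' t.carrier := by
  show (fun y => y + (t.puncture + x)) '' t.proto.carrier
    = (fun y => y + x) '' ((fun y => y + t.puncture) '' t.proto.carrier)
  rw [image_image]
  refine image_congr fun y _ => ?_
  exact (add_assoc _ _ _).symm

theorem aux_tr_supp {n : ℕ} (P : Set (Tile n)) (x : Rn n) :
    tsupport' (translateSet P x) = (Homeomorph.addRight x) '' tsupport' P := by
  simp only [tsupport', translateSet, biUnion_image, image_iUnion, aux_tr_carrier]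

theorem aux_tr_conn {n : ℕ} (P : Set (Tile n)) (x : Rn n) (h : IsConnected (interior (tsupport' P))) :
    IsConnected (interior (tsupport' (translateSet P x))) := by
  rw [aux_tr_supp, ← Homeomorph.image_interior]
  exact h.image _ (Homeomorph.continuous _).continuousOn

/-- For any partial tiling `T₀` contained in some tiling of the punctured hull and whose
support contains the origin, the set `ξ_{T₀} = {[t,P,t] : t = T₀(0), t ∈ P ⊆ T₀}` is a
filter in the idempotent semilattice of the tiling inverse semigroup. -/
theorem xiOf_isFilter {n : ℕ} (T : Set (Tile n)) (hT : IsTiling T)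
    (hFLC : FLC T) (hrep : Repetitive T) (hap : StronglyAperiodic T)
    (T₀ : Set (Tile n)) (hpt : IsPartialTiling T₀) (h0 : (0 : Rn n) ∈ tsupport' T₀)
    (hsub : ∃ T' ∈ puncturedHull T, T₀ ⊆ T') :
    IsFilterE T (xiOf T T₀) := by
  obtain ⟨T', ⟨⟨hT', hocc⟩, t', ht', ht'0⟩, hsubT⟩ := hsub
  refine ⟨?_, fun e he => he.1, ?_, ?_⟩
  · obtain ⟨t, ht, h0t⟩ := mem_iUnion₂.1 h0
    have htt : t = t' := by
      by_contra hne
      have hd := hT'.1 (hsubT ht) ht' hne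
      obtain ⟨z, hz1, hz2⟩ := mem_closure_iff.1 ((aux_carrier t).2 h0t) _ isOpen_interior
        (aux_puncture t' ht'0)
      exact (hd ▸ (⟨hz2, hz1⟩ : z ∈ interior t.carrier ∩ interior t'.carrier) : z ∈ (∅ : Set (Rn n)))
    subst htt
    have hpatch : IsPatch ({t} : Set (Tile n)) :=
      ⟨pairwise_singleton _ _, finite_singleton _⟩
    refine ⟨⟨t, t, {t}, rfl, rfl, hpatch, ?_, hocc {t} (by simpa using ht') hpatch⟩, rfl, 0, ?_, ?_, ?_⟩
    · have : tsupport' ({t} : Set (Tile n)) = t.carrier := by simp [tsupport']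
      rw [this]; exact (aux_carrier t).1
    · simp [Tile.translate, ht'0]
    · simpa [Tile.translate] using ht
    · simpa [Tile.translate, translateSet] using ht
  · rintro e ⟨he, x, hx0, hxm, hxP⟩ f hf ⟨y, hy, hyP⟩
    refine ⟨hf, y + x, ?_, ?_, ?_⟩
    · rw [← aux_tr_tr, hy]; exact hx0
    · rw [← aux_tr_tr, hy]; exact hxm
    · rw [← aux_trS]
      exact (image_mono hyP).trans hxP
  · rintro e ⟨he, x, hx0, hxm, hxP⟩ f ⟨hf, y, hy0, hym, hyP⟩
    have hef : e.t1.translate x = f.t1.translate y := by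
      by_contra hne
      have hd := hpt hxm hym hne
      exact (hd ▸ (⟨aux_puncture _ hx0, aux_puncture _ hy0⟩ :
        (0 : Rn n) ∈ interior (e.t1.translate x).carrier ∩ interior (f.t1.translate y).carrier) :
        (0 : Rn n) ∈ (∅ : Set (Rn n)))
    have hme : e.t1.translate x ∈ translateSet e.P x := ⟨_, e.mem1, rfl⟩
    have hmf : f.t1.translate y ∈ translateSet f.P y := ⟨_, f.mem1, rfl⟩
    have hsubQ : translateSet e.P x ∪ translateSet f.P y ⊆ T₀ := union_subset hxP hyP
    have hpatch : IsPatch (translateSet e.P x ∪ translateSet f.P y) :=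
      ⟨hpt.mono hsubQ, (e.patch.2.image _).union (f.patch.2.image _)⟩
    have hmem0 : ∀ (P : Set (Tile n)) (t : Tile n), t ∈ P → t.puncture = 0 →
        (0 : Rn n) ∈ interior (tsupport' P) := fun P t ht h0 =>
      interior_mono (fun z hz => mem_iUnion₂.2 ⟨t, ht, hz⟩) (aux_puncture t h0)
    have hconn : IsConnected (interior (tsupport' (translateSet e.P x ∪ translateSet f.P y))) := by
      have hU : tsupport' (translateSet e.P x ∪ translateSet f.P y)
          = tsupport' (translateSet e.P x) ∪ tsupport' (translateSet f.P y) := by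
        simp only [tsupport', biUnion_union]
      rw [hU]
      refine IsConnected.subset_closure
        (IsConnected.union ⟨0, hmem0 _ _ hme hx0, hmem0 _ _ hmf hy0⟩
          (aux_tr_conn e.P x e.conn) (aux_tr_conn f.P y f.conn))
        (union_subset (interior_mono subset_union_left) (interior_mono subset_union_right)) ?_
      rw [closure_union]
      exact interior_subset.trans (union_subset_union (aux_supp _) (aux_supp _))
    refine ⟨⟨e.t1.translate x, e.t1.translate x, _, Or.inl hme, Or.inl hme, hpatch, hconn,
      hocc _ (hsubQ.trans hsubT) hpatch⟩, ⟨rfl, 0, ?_, ?_, ?_⟩, ⟨x, rfl, subset_union_left⟩,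
      ⟨y, hef.symm, subset_union_right⟩⟩
    · simpa [Tile.translate] using hx0
    · simpa [Tile.translate] using hxm
    · simpa [Tile.translate, translateSet] using hsubQ
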